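/- For every n ≥ 1, let μ_k = (1/b_n)·Σ_{V(T)=n} (J(T) − (n−1)/2)^k ∈ ℚ be the k-th central moment of the number-of-jumps statistic over the uniform distribution on full binary trees with n internal vertices. Then μ_4·(2n³ − 3n² − 2n + 3) = μ_2²·(6n³ − 11n² − 2n + 3); equivalently, whenever μ_2 ≠ 0, the kurtosis μ_4/μ_2² equals (6n³ − 11n² − 2n + 3)/(2n³ − 3n² − 2n + 3). -/

import Mathlib

inductive BTree : Type
  | leaf : BTree
  | node : BTree → BTree → BTree

namespace BTree

/-- number of internal vertices -/
def V : BTree → ℕ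
  | leaf => 0
  | node l r => V l + V r + 1

/-- depth of the rightmost leaf -/
def D : BTree → ℕ
  | leaf => 0
  | node _ r => 1 + D r

/-- number of jumps -/
def J : BTree → ℕ
  | leaf => 0
  | node leaf r => J r
  | node (node l₁ r₁) r => J (node l₁ r₁) + J r + 1

/-- sum of jump distances -/
def JD : BTree → ℕ
  | leaf => 0
  | node l r => JD l + JD r + D l

end BTree

namespace BTree
open Polynomial

lemma finite_le (n : ℕ) : {T : BTree | T.V ≤ n}.Finite := by
  induction n with
  | zero =>
    apply (Set.finite_singleton leaf).subset
    intro T hT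
    cases T with
    | leaf => simp
    | node l r => simp [V] at hT
  | succ n ih =>
    apply ((ih.image2 node ih).insert leaf).subset
    intro T hT
    cases T with
    | leaf => simp
    | node l r =>
      simp only [V, Set.mem_setOf_eq] at hT
      right
      exact ⟨l, by simp; omega, r, by simp; omega, rfl⟩

lemma finite_eq (n : ℕ) : {T : BTree | T.V = n}.Finite :=
  (finite_le n).subset (fun _ h => le_of_eq h)

noncomputable def trees (n : ℕ) : Finset BTree := (finite_eq n).toFinset

lemma mem_trees {n : ℕ} {T : BTree} : T ∈ trees n ↔ T.V = n := by simp [trees]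

lemma trees_zero : trees 0 = {leaf} := by
  ext T
  rw [mem_trees]
  cases T <;> simp [V]

lemma sum_succ {M : Type*} [AddCommMonoid M] (f : BTree → M) (n : ℕ) :
    ∑ T ∈ trees (n+1), f T =
      ∑ p ∈ Finset.HasAntidiagonal.antidiagonal n, ∑ q ∈ trees p.1 ×ˢ trees p.2, f (node q.1 q.2) := by
  rw [Finset.sum_sigma']
  symm
  refine Finset.sum_bij (fun a _ => node a.2.1 a.2.2) ?_ ?_ ?_ ?_
  · rintro ⟨⟨i, j⟩, ⟨l, r⟩⟩ h
    simp only [Finset.mem_sigma, Finset.HasAntidiagonal.mem_antidiagonal, Finset.mem_product, mem_trees] at h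
    rw [mem_trees]; simp only [V]; omega
  · rintro ⟨⟨i, j⟩, ⟨l, r⟩⟩ h ⟨⟨i', j'⟩, ⟨l', r'⟩⟩ h' e
    simp only [Finset.mem_sigma, Finset.HasAntidiagonal.mem_antidiagonal, Finset.mem_product, mem_trees] at h h'
    simp only [node.injEq] at e
    obtain ⟨rfl, rfl⟩ := e
    obtain ⟨_, rfl, rfl⟩ := h
    obtain ⟨_, rfl, rfl⟩ := h'
    rfl
  · intro T hT
    rw [mem_trees] at hT
    cases T with
    | leaf => simp [V] at hT
    | node l r =>
      simp only [V] at hT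
      refine ⟨⟨(l.V, r.V), (l, r)⟩, ?_, rfl⟩
      simp [mem_trees]; omega
  · intros; rfl

noncomputable def F (n : ℕ) : ℚ[X] := ∑ T ∈ trees n, (1 + X) ^ T.J

lemma F_zero : F 0 = 1 := by simp [F, trees_zero, J]

open Classical in
lemma J_node (l r : BTree) : (1 + X : ℚ[X]) ^ (node l r).J =
    ((1 + X) * (1 + X) ^ l.J - if l = leaf then X else 0) * (1 + X) ^ r.J := by
  cases l with
  | leaf => simp [J]
  | node a b => simp [J]; ring

lemma F_succ (n : ℕ) : F (n+1) =
    ∑ p ∈ Finset.HasAntidiagonal.antidiagonal n, ((1 + X) * F p.1 - if p.1 = 0 then X else 0) * F p.2 := by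
  classical
  rw [F, sum_succ]
  refine Finset.sum_congr rfl fun p _ => ?_
  simp only [J_node]
  have key : ∑ l ∈ trees p.1, ((1 + X : ℚ[X]) * (1 + X) ^ l.J - if l = leaf then X else 0) =
      (1 + X) * F p.1 - if p.1 = 0 then X else 0 := by
    rw [Finset.sum_sub_distrib, F, Finset.mul_sum]
    congr 1
    rw [Finset.sum_ite_eq']
    simp [mem_trees, V, eq_comm]
  rw [← key, F, Finset.sum_mul_sum, Finset.sum_product]

noncomputable def Fs : PowerSeries ℚ[X] := PowerSeries.mk F

local notation "tt" => (PowerSeries.C (X : ℚ[X]))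
local notation "zz" => (PowerSeries.X : PowerSeries ℚ[X])

lemma Fs_eq : Fs = 1 + zz * (((1 + tt) * Fs - tt) * Fs) := by
  ext1 n
  cases n with
  | zero => simp [Fs, F_zero]
  | succ n =>
    rw [map_add, PowerSeries.coeff_succ_X_mul, PowerSeries.coeff_mul, Fs, PowerSeries.coeff_mk, F_succ]
    simp only [PowerSeries.coeff_one, PowerSeries.coeff_mk]
    rw [if_neg (by omega), zero_add]
    refine Finset.sum_congr rfl fun p _ => ?_
    congr 1
    have : (1 + tt : PowerSeries ℚ[X]) = PowerSeries.C (1 + X) := by simp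
    rw [this, map_sub, PowerSeries.coeff_C_mul, PowerSeries.coeff_C, PowerSeries.coeff_mk]

noncomputable def S : PowerSeries ℚ[X] := 1 + tt * zz - 2 * (1 + tt) * zz * Fs

noncomputable def Dl : PowerSeries ℚ[X] := 1 - (4 + 2 * tt) * zz + tt ^ 2 * zz ^ 2

lemma S_sq : S * S = Dl := by
  have h := Fs_eq
  unfold S Dl
  linear_combination (-4 * (1 + tt) * zz) * h

lemma S_ne : S ≠ 0 := by
  intro h
  have := congrArg PowerSeries.constantCoeff h
  simp [S] at this

lemma deriv_sq {R : Type*} [CommRing R] (g : PowerSeries R) :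
    PowerSeries.derivative R (g * g) = 2 * g * PowerSeries.derivative R g := by
  rw [Derivation.leibniz, smul_eq_mul]; ring

lemma S_ode : 2 * (Dl * PowerSeries.derivative ℚ[X] S) = PowerSeries.derivative ℚ[X] Dl * S := by
  apply mul_left_cancel₀ S_ne
  have h : PowerSeries.derivative ℚ[X] Dl = 2 * S * PowerSeries.derivative ℚ[X] S := by
    rw [← S_sq, deriv_sq]
  rw [h, ← S_sq]; ring

lemma dDl : PowerSeries.derivative ℚ[X] Dl = PowerSeries.C (-(4 + 2 * X)) + PowerSeries.C (2 * X ^ 2) * zz := by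
  ext1 n
  rw [PowerSeries.coeff_derivative]
  have : Dl = 1 - PowerSeries.C (4 + 2 * X) * zz + PowerSeries.C (X^2) * zz ^ 2 := by
    simp only [Dl, map_add, map_mul, map_pow, map_ofNat]
  rw [this]
  simp only [map_add, map_sub, PowerSeries.coeff_C_mul, PowerSeries.coeff_one, PowerSeries.coeff_X, PowerSeries.coeff_X_pow, PowerSeries.coeff_C]
  rcases n with _ | _ | n
  · simp
  · simp; norm_num; ring
  · simp

lemma coeff_S (n : ℕ) : PowerSeries.coeff (n+2) S = -2 * (1 + X) * F (n+1) := by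
  have : S = 1 + PowerSeries.C X * zz - zz * (PowerSeries.C (2 * (1 + X)) * Fs) := by
    simp only [S, map_add, map_mul, map_one, map_ofNat]; ring
  rw [this, map_sub, PowerSeries.coeff_succ_X_mul, PowerSeries.coeff_C_mul, map_add, PowerSeries.coeff_C_mul]
  simp [Fs, PowerSeries.coeff_one, PowerSeries.coeff_X]

lemma S_rec (m : ℕ) : 
    2 * (((m:ℚ[X]) + 3) * PowerSeries.coeff (m+3) S - (4 + 2 * X) * (((m:ℚ[X]) + 2) * PowerSeries.coeff (m+2) S)
      + X ^ 2 * (((m:ℚ[X])+1) * PowerSeries.coeff (m+1) S)) =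
    -(4 + 2 * X) * PowerSeries.coeff (m+2) S + 2 * X ^ 2 * PowerSeries.coeff (m+1) S := by
  have h := congrArg (PowerSeries.coeff (m+2)) S_ode
  rw [dDl] at h
  have e1 : 2 * (Dl * PowerSeries.derivative ℚ[X] S) =
     PowerSeries.C 2 * (PowerSeries.derivative ℚ[X] S - zz * (PowerSeries.C (4 + 2 * X) * PowerSeries.derivative ℚ[X] S)
       + zz * (zz * (PowerSeries.C (X^2) * PowerSeries.derivative ℚ[X] S))) := by
    simp only [Dl, map_add, map_mul, map_one, map_pow, map_ofNat]; ring
  have e2 : (PowerSeries.C (-(4 + 2 * X)) + PowerSeries.C (2 * X ^ 2) * zz) * S =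
     PowerSeries.C (-(4 + 2 * X)) * S + zz * (PowerSeries.C (2 * X ^ 2) * S) := by ring
  rw [e1, e2] at h
  simp only [map_add (PowerSeries.coeff (m+2)), map_sub (PowerSeries.coeff (m+2)), PowerSeries.coeff_C_mul, PowerSeries.coeff_succ_X_mul,
    PowerSeries.coeff_derivative] at h
  push_cast at h
  linear_combination h

lemma F_rec (m : ℕ) : ((m:ℚ[X]) + 4) * F (m+3) = (2 + X) * (2 * (m:ℚ[X]) + 5) * F (m+2) - X ^ 2 * ((m:ℚ[X])+1) * F (m+1) := by
  have h := S_rec (m+1)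
  rw [show m+1+3 = (m+2)+2 by ring, show m+1+2 = (m+1)+2 by ring, show m+1+1 = m+2 by ring,
    coeff_S, coeff_S, coeff_S] at h
  have hx : (1 + X : ℚ[X]) ≠ 0 := by
    intro h
    have := congrArg (eval 0) h
    simp at this
  have h4 : (-4 * (1 + X) : ℚ[X]) ≠ 0 := mul_ne_zero (by norm_num) hx
  apply mul_left_cancel₀ h4
  push_cast at h
  linear_combination h

/-- sum of binomials -/
noncomputable def f (n j : ℕ) : ℚ := (F n).coeff j

lemma f_eq (n j : ℕ) : f n j = ∑ T ∈ trees n, (T.J.choose j : ℚ) := by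
  simp [f, F, finsetSum_coeff, coeff_one_add_X_pow]

lemma f_rec0 (m : ℕ) : ((m:ℚ) + 4) * f (m+3) 0 = (2 * m + 5) * (2 * f (m+2) 0) := by
  have h := congrArg (eval 0) (F_rec m)
  simp only [f, coeff_zero_eq_eval_zero]
  simp at h
  linear_combination h

lemma F_rec' (m : ℕ) : C ((m:ℚ) + 4) * F (m+3) =
    C (2 * (2 * (m:ℚ) + 5)) * F (m+2) + X * (C (2 * (m:ℚ) + 5) * F (m+2)) - X * (X * (C ((m:ℚ)+1) * F (m+1))) := by
  have h := F_rec m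
  simp only [map_add, map_mul, map_natCast, map_one, map_ofNat]
  linear_combination h

lemma f_rec1 (m : ℕ) : ((m:ℚ) + 4) * f (m+3) 1 = (2 * m + 5) * (2 * f (m+2) 1 + f (m+2) 0) := by
  have h := congrArg (fun p : ℚ[X] => coeff p 1) (F_rec' m)
  rw [show (1:ℕ) = 0+1 from rfl] at h
  simp only [coeff_sub, coeff_add _ _ (0+1), coeff_C_mul, coeff_X_mul, mul_coeff_zero X, coeff_X_zero] at h
  simp only [f]
  linear_combination h

lemma f_rec2 (m j : ℕ) : ((m:ℚ) + 4) * f (m+3) (j+2) =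
    (2 * m + 5) * (2 * f (m+2) (j+2) + f (m+2) (j+1)) - (m+1) * f (m+1) j := by
  have h := congrArg (fun p : ℚ[X] => coeff p (j+2)) (F_rec' m)
  simp only [coeff_sub, coeff_add _ _ (j+2), coeff_C_mul, coeff_X_mul _ (j+1), coeff_X_mul _ j] at h
  simp only [f]
  linear_combination h

lemma F_one : F 1 = 1 := by
  rw [F_succ]; simp [F_zero]

lemma F_two : F 2 = 2 + X := by
  rw [F_succ]
  rw [show Finset.HasAntidiagonal.antidiagonal 1 = {(0,1),(1,0)} from rfl]
  simp [F_zero, F_one]; ring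

lemma f_one (j : ℕ) : f 1 j = if j = 0 then 1 else 0 := by
  simp [f, F_one, coeff_one]

lemma f_two (j : ℕ) : f 2 j = (if j = 0 then 2 else 0) + if j = 1 then 1 else 0 := by
  rw [f, F_two, coeff_add, coeff_X, show (2:ℚ[X]) = C 2 from rfl, coeff_C]
  simp [eq_comm]

lemma closed (n : ℕ) :
    (f (n+1) 1 = f (n+1) 0 * (n / 2)) ∧
    (f (n+1) 2 = f (n+1) 0 * (n^2 * (n-1) / (4 * (2 * n + 1)))) ∧
    (f (n+1) 3 = f (n+1) 0 * (n * (n-1)^2 * (n-2) / (24 * (2 * n + 1)))) ∧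
    (f (n+1) 4 = f (n+1) 0 * (n * (n-1)^2 * (n-2)^2 * (n-3) / (96 * (2 * n + 1) * (2 * n - 1)))) ∧
    ((n + 3 : ℚ) * f (n+2) 0 = 2 * (2 * n + 3) * f (n+1) 0) := by
  induction n using Nat.strong_induction_on with
  | _ n ih =>
    rcases n with _ | _ | n
    · simp [f_one, f_two]; norm_num
    · have := f_rec0 0
      simp [f_two] at this ⊢
      norm_num at this ⊢
      linarith
    · obtain ⟨a1, a2, a3, a4, a0⟩ := ih n (by omega)
      obtain ⟨b1, b2, b3, b4, b0⟩ := ih (n+1) (by omega)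
      have r0 := f_rec0 n
      have r1 := f_rec1 n
      have r2 := f_rec2 n 0
      have r3 := f_rec2 n 1
      have r4 := f_rec2 n 2
      have s0 := f_rec0 (n+1)
      simp only [show n + 1 + 1 = n + 2 from rfl, show n + 2 + 1 = n + 3 from rfl, show n + 1 + 2 = n + 3 from rfl, show n + 2 + 2 = n + 4 from rfl, show n + 1 + 3 = n + 4 from rfl, zero_add, Nat.reduceAdd] at *
      push_cast at *
      have p1 : (2 * (n:ℚ) + 3) ≠ 0 := by positivity
      have p2 : (2 * (n:ℚ) + 1) ≠ 0 := by positivity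
      have p3 : (2 * (n:ℚ) + 5) ≠ 0 := by positivity
      have p4 : (n:ℚ) + 4 ≠ 0 := by positivity
      have p5 : (n:ℚ) + 3 ≠ 0 := by positivity
      have p6 : (2 * (n:ℚ) - 1) ≠ 0 := by
        intro h
        have : (2 * (n:ℤ) - 1) = 0 := by exact_mod_cast h
        omega
      have q1 : (2 * ((n:ℚ) + 1) + 1) ≠ 0 := by positivity
      have q2 : (2 * ((n:ℚ) + 2) + 1) ≠ 0 := by positivity
      have q3 : (2 * ((n:ℚ) + 1) - 1) ≠ 0 := by convert p2 using 1; ring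
      have q4 : (2 * ((n:ℚ) + 2) - 1) ≠ 0 := by convert p1 using 1; ring
      have e1 : f (n+1) 0 = (n+3) * f (n+2) 0 / (2 * (2 * n + 3)) := by
        field_simp; linear_combination -a0
      have e3 : f (n+3) 0 = 2 * (2 * n + 5) * f (n+2) 0 / (n + 4) := by
        field_simp; linear_combination r0
      refine ⟨?_, ?_, ?_, ?_, ?_⟩
      · apply mul_left_cancel₀ p4
        rw [r1, b1, e3]; field_simp; ring
      · apply mul_left_cancel₀ p4
        rw [r2, b1, b2, e3, e1]; field_simp; ring
      · apply mul_left_cancel₀ p4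
        rw [r3, b2, b3, a1, e3, e1]; field_simp; ring
      · apply mul_left_cancel₀ p4
        rw [r4, b3, b4, a2, e3, e1]; field_simp; ring
      · linear_combination s0

lemma pow_choose (k : ℕ) : (k:ℚ) = k.choose 1 ∧ (k:ℚ)^2 = 2 * k.choose 2 + k.choose 1 ∧
    (k:ℚ)^3 = 6 * k.choose 3 + 6 * k.choose 2 + k.choose 1 ∧
    (k:ℚ)^4 = 24 * k.choose 4 + 36 * k.choose 3 + 14 * k.choose 2 + k.choose 1 := by
  induction k with
  | zero => simp
  | succ k ih =>
    obtain ⟨h1, h2, h3, h4⟩ := ih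
    simp only [Nat.choose_succ_succ' k, Nat.choose_zero_right, zero_add, Nat.reduceAdd]
    push_cast
    refine ⟨?_, ?_, ?_, ?_⟩
    · linear_combination h1
    · linear_combination h2 + 2 * h1
    · linear_combination h3 + 3 * h2 + 3 * h1
    · linear_combination h4 + 4 * h3 + 6 * h2 + 4 * h1

lemma mom2 (n : ℕ) (m : ℚ) : ∑ T ∈ trees n, ((T.J : ℚ) - m) ^ 2 =
    2 * f n 2 + (1 - 2 * m) * f n 1 + m ^ 2 * f n 0 := by
  simp only [f_eq, Finset.mul_sum, ← Finset.sum_add_distrib]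
  refine Finset.sum_congr rfl fun T _ => ?_
  obtain ⟨h1, h2, h3, h4⟩ := pow_choose T.J
  rw [Nat.choose_zero_right]; push_cast
  linear_combination h2 - 2 * m * h1

lemma mom4 (n : ℕ) (m : ℚ) : ∑ T ∈ trees n, ((T.J : ℚ) - m) ^ 4 =
    24 * f n 4 + (36 - 24 * m) * f n 3 + (14 - 24 * m + 12 * m ^ 2) * f n 2
     + (1 - 4 * m + 6 * m ^ 2 - 4 * m ^ 3) * f n 1 + m ^ 4 * f n 0 := by
  simp only [f_eq, Finset.mul_sum, ← Finset.sum_add_distrib]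
  refine Finset.sum_congr rfl fun T _ => ?_
  obtain ⟨h1, h2, h3, h4⟩ := pow_choose T.J
  rw [Nat.choose_zero_right]; push_cast
  linear_combination h4 - 4 * m * h3 + 6 * m ^ 2 * h2 - 4 * m ^ 3 * h1

lemma card_eq (n : ℕ) : (Nat.card {T : BTree // T.V = n} : ℚ) = f n 0 := by
  have : Nat.card {T : BTree // T.V = n} = (trees n).card := by
    exact Set.ncard_eq_toFinset_card _ (finite_eq n)
  rw [this, f_eq]; simp

lemma finsum_eq (n : ℕ) (g : BTree → ℚ) : ∑ᶠ T ∈ {T : BTree | T.V = n}, g T = ∑ T ∈ trees n, g T :=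
  finsum_mem_eq_finite_toFinset_sum g (finite_eq n)

end BTree


/-- The kurtosis of the number-of-jumps statistic over full binary trees with
n ≥ 1 internal vertices: μ₄·(2n³ − 3n² − 2n + 3) = μ₂²·(6n³ − 11n² − 2n + 3),
where μₖ is the k-th central moment of J about its mean (n−1)/2. -/
theorem stmt_11 (n : ℕ) (hn : 1 ≤ n)
    (μ : ℕ → ℚ)
    (hμ : ∀ k, μ k =
      (∑ᶠ T ∈ {T : BTree | T.V = n}, ((T.J : ℚ) - ((n : ℚ) - 1) / 2) ^ k) /
        (Nat.card {T : BTree // T.V = n} : ℚ)) :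
    μ 4 * (2 * (n : ℚ) ^ 3 - 3 * n ^ 2 - 2 * n + 3) =
      (μ 2) ^ 2 * (6 * (n : ℚ) ^ 3 - 11 * n ^ 2 - 2 * n + 3) := by
  obtain ⟨n, rfl⟩ : ∃ k, n = k + 1 := ⟨n - 1, by omega⟩
  obtain ⟨h1, h2, h3, h4, -⟩ := BTree.closed n
  rw [hμ, hμ, BTree.finsum_eq, BTree.finsum_eq, BTree.mom2, BTree.mom4, BTree.card_eq, h1, h2, h3, h4]
  have p2 : (2 * (n:ℚ) + 1) ≠ 0 := by positivity
  have p6 : (2 * (n:ℚ) - 1) ≠ 0 := by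
    intro h
    have : (2 * (n:ℤ) - 1) = 0 := by exact_mod_cast h
    omega
  have hm : (((n + 1 : ℕ) : ℚ) - 1) / 2 = n / 2 := by push_cast; ring
  rw [hm]
  generalize BTree.f (n+1) 0 = c
  by_cases hc : c = 0
  · simp [hc]
  push_cast
  generalize (n : ℚ) = x at *
  have m2 : (2 * (c * (x ^ 2 * (x - 1) / (4 * (2 * x + 1)))) + (1 - 2 * (x / 2)) * (c * (x / 2))
      + (x / 2) ^ 2 * c) / c = x * (x + 2) / (4 * (2 * x + 1)) := by
    field_simp; ring
  have m4 : (24 * (c * (x * (x - 1) ^ 2 * (x - 2) ^ 2 * (x - 3) / (96 * (2 * x + 1) * (2 * x - 1)))) +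
      (36 - 24 * (x / 2)) * (c * (x * (x - 1) ^ 2 * (x - 2) / (24 * (2 * x + 1)))) +
      (14 - 24 * (x / 2) + 12 * (x / 2) ^ 2) * (c * (x ^ 2 * (x - 1) / (4 * (2 * x + 1)))) +
      (1 - 4 * (x / 2) + 6 * (x / 2) ^ 2 - 4 * (x / 2) ^ 3) * (c * (x / 2)) + (x / 2) ^ 4 * c) / c
      = x * (x + 2) * (3 * x ^ 2 + 2 * x - 4) / (16 * (2 * x + 1) * (2 * x - 1)) := by
    obtain ⟨y, hy⟩ : ∃ y, y = 2 * x - 1 := ⟨_, rfl⟩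
    obtain ⟨w, hw⟩ : ∃ w, w = 2 * x + 1 := ⟨_, rfl⟩
    rw [← hy] at p6 ⊢
    rw [← hw] at p2 ⊢
    field_simp
    rw [hy, hw]
    ring
  rw [m2, m4]
  obtain ⟨y, hy⟩ : ∃ y, y = 2 * x - 1 := ⟨_, rfl⟩
  obtain ⟨w, hw⟩ : ∃ w, w = 2 * x + 1 := ⟨_, rfl⟩
  rw [← hy] at p6 ⊢
  rw [← hw] at p2 ⊢
  field_simp
  rw [hy, hw]
  ring
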